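/- Let a > 0 and suppose there is a function φ : ℝ → ℝ such that: (1) φ is continuous, even, and strictly positive; (2) the integral over ℝ of 1/φ(t) is finite; (3) for every real x one has φ(e^{a·x}) ≥ a·e^{a·x}·φ(x), and the set of x for which equality holds is finite. Then for every sign sequence ε the set I(ε) is a subsingleton. -/

import Mathlib

open Filter Topology

/-- Exponential on the extended real line, with e^{-∞}=0 and e^{+∞}=+∞. -/
noncomputable def eexp (y : EReal) : EReal :=
  if y = ⊥ then (0 : EReal) else if y = ⊤ then ⊤ else ((Real.exp y.toReal : ℝ) : EReal)

/-- `fSgn a s` is `f₊ : x ↦ e^{a·x}` when `s = true` and `f₋ : x ↦ -e^{a·x}` when `s = false`. -/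
noncomputable def fSgn (a : ℝ) (s : Bool) (x : EReal) : EReal :=
  if s then eexp ((a : EReal) * x) else -eexp ((a : EReal) * x)

/-- `uSeq a n ε = f_{ε₁}(f_{ε₂}(⋯ f_{ε_n}(1)⋯))`, where `ε (k-1)` is the k-th sign. -/
noncomputable def uSeq (a : ℝ) : ℕ → (ℕ → Bool) → EReal
  | 0, _ => 1
  | n + 1, ε => fSgn a (ε 0) (uSeq a n (fun k => ε (k + 1)))

/-- `ε` represents `t` if `(u_{n,ε})_n` tends to `t` in `EReal`. -/
def Represents (a : ℝ) (ε : ℕ → Bool) (t : EReal) : Prop :=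
  Filter.Tendsto (fun n => uSeq a n ε) Filter.atTop (nhds t)

/-- `t` is representable if some sign sequence represents it. -/
def Representable (a : ℝ) (t : EReal) : Prop :=
  ∃ ε : ℕ → Bool, Represents a ε t

/-- For a finite word `γ = γ₁⋯γ_k`, `fWord a γ = f_{γ₁} ∘ ⋯ ∘ f_{γ_k}`. -/
noncomputable def fWord (a : ℝ) (γ : List Bool) (x : EReal) : EReal :=
  γ.foldr (fSgn a) x

/-- `I(ε) = ⋂ₙ I(n,ε)` where `I(n,ε)` is the image of `EReal` under `f_{ε₁} ∘ ⋯ ∘ f_{ε_n}`. -/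
noncomputable def Iset (a : ℝ) (ε : ℕ → Bool) : Set EReal :=
  ⋂ n : ℕ, Set.range (fWord a (List.ofFn fun i : Fin n => ε i))

/-- `X` is the union over all finite words `γ` of the images `f_γ(]m,+∞])`. -/
noncomputable def Xset (a m : ℝ) : Set EReal :=
  ⋃ γ : List Bool, fWord a γ '' Set.Ioi (m : EReal)
lemma aux_eexp (y : EReal) : eexp y = ((EReal.exp y : ENNReal) : EReal) := by
  induction y with
  | bot => simp [eexp]
  | top => simp [eexp]
  | coe r =>
    simp [eexp, EReal.exp_coe, EReal.coe_ennreal_ofReal, (Real.exp_pos r).le]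

lemma aux_cont (a : ℝ) (ha : 0 < a) : Continuous (fSgn a true) := by
  have : fSgn a true = fun x => ((EReal.exp ((a : EReal) * x) : ENNReal) : EReal) := by
    funext x; simp [fSgn, aux_eexp]
  rw [this]
  have hm : Continuous fun x : EReal => (a : EReal) * x := by
    rw [continuous_iff_continuousAt]
    intro x
    have h0 : (a : EReal) ≠ 0 := by exact_mod_cast ha.ne'
    exact ContinuousAt.comp (g := fun p : EReal × EReal => p.1 * p.2)
      (EReal.continuousAt_mul (p := ((a : EReal), x)) (Or.inl h0) (Or.inl h0)
        (Or.inl (EReal.coe_ne_bot a)) (Or.inl (EReal.coe_ne_top a)))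
      (continuousAt_const.prodMk continuousAt_id)
  exact continuous_coe_ennreal_ereal.comp (ENNReal.continuous_exp.comp hm)

lemma aux_lt (a : ℝ) (ha : 0 < a) (t : ℝ) (x : EReal) :
    fSgn a true x < ((Real.exp (a * t) : ℝ) : EReal) ↔ x < t := by
  induction x with
  | bot =>
    simp [fSgn, eexp, EReal.coe_mul_bot_of_pos ha, Real.exp_pos]
  | top => simp [fSgn, eexp, EReal.coe_mul_top_of_pos ha]
  | coe r =>
    rw [fSgn, ← EReal.coe_mul]
    simp [eexp, ha, -EReal.coe_mul]

lemma aux_gt (a : ℝ) (ha : 0 < a) (t : ℝ) (x : EReal) :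
    ((Real.exp (a * t) : ℝ) : EReal) < fSgn a true x ↔ (t : EReal) < x := by
  induction x with
  | bot =>
    simp [fSgn, eexp, EReal.coe_mul_bot_of_pos ha, (Real.exp_pos _).le]
  | top => simp [fSgn, eexp, EReal.coe_mul_top_of_pos ha]
  | coe r =>
    rw [fSgn, ← EReal.coe_mul]
    simp [eexp, ha, -EReal.coe_mul]

lemma aux_nonneg (a : ℝ) (x : EReal) : 0 ≤ fSgn a true x := by
  simp only [fSgn, aux_eexp, if_true]
  exact EReal.coe_ennreal_nonneg _

lemma aux_false (a : ℝ) (x : EReal) : fSgn a false x = - fSgn a true x := by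
  simp [fSgn]

lemma aux_mono (a : ℝ) (ha : 0 < a) : StrictMono (fSgn a true) := by
  intro x y h
  obtain ⟨t, h1, h2⟩ := EReal.lt_iff_exists_real_btwn.1 h
  exact ((aux_lt a ha t x).2 h1).trans ((aux_gt a ha t y).2 h2)

lemma aux_inj (a : ℝ) (ha : 0 < a) (s : Bool) : Function.Injective (fSgn a s) := by
  cases s
  · intro x y h
    rw [aux_false, aux_false, neg_inj] at h
    exact (aux_mono a ha).injective h
  · exact (aux_mono a ha).injective

lemma aux_word_inj (a : ℝ) (ha : 0 < a) (γ : List Bool) : Function.Injective (fWord a γ) := by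
  induction γ with
  | nil => intro x y h; simpa [fWord] using h
  | cons s γ ih =>
    intro x y h
    exact ih (aux_inj a ha s h)

lemma aux_seq (a : ℝ) (ha : 0 < a) (ε : ℕ → Bool) (x : EReal) (hx : x ∈ Iset a ε) :
    ∃ p : ℕ → EReal, p 0 = x ∧ ∀ n, p n = fSgn a (ε n) (p (n + 1)) := by
  have h : ∀ n : ℕ, ∃ z, fWord a (List.ofFn fun i : Fin n => ε i) z = x := by
    intro n
    exact Set.mem_iInter.1 hx n
  choose p hp using h
  refine ⟨p, by simpa [fWord] using hp 0, fun n => ?_⟩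
  apply aux_word_inj a ha (List.ofFn fun i : Fin n => ε i)
  rw [hp n, ← hp (n + 1), List.ofFn_succ']
  simp [fWord]

/-- Real points strictly between `x` and `y`. -/
def rbtw (p : EReal × EReal) : Set ℝ :=
  {t : ℝ | (p.1 < t ∧ (t : EReal) < p.2) ∨ (p.2 < t ∧ (t : EReal) < p.1)}

lemma btw_open (p : EReal × EReal) : IsOpen (rbtw p) := by
  have h : ∀ x : EReal, IsOpen {t : ℝ | x < t} := fun x =>
    isOpen_lt continuous_const continuous_coe_real_ereal
  have h' : ∀ x : EReal, IsOpen {t : ℝ | (t : EReal) < x} := fun x =>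
    isOpen_lt continuous_coe_real_ereal continuous_const
  exact ((h _).inter (h' _)).union ((h _).inter (h' _))

lemma btw_nonempty {x y : EReal} (h : x ≠ y) : (rbtw (x, y)).Nonempty := by
  rcases lt_or_gt_of_ne h with h | h
  · obtain ⟨t, h1, h2⟩ := EReal.lt_iff_exists_real_btwn.1 h
    exact ⟨t, Or.inl ⟨h1, h2⟩⟩
  · obtain ⟨t, h1, h2⟩ := EReal.lt_iff_exists_real_btwn.1 h
    exact ⟨t, Or.inr ⟨h1, h2⟩⟩

lemma btw_image (a : ℝ) (ha : 0 < a) (x y : EReal) :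
    (fun t => Real.exp (a * t)) '' rbtw (x, y) = rbtw (fSgn a true x, fSgn a true y) := by
  ext s
  constructor
  · rintro ⟨t, ht, rfl⟩
    simpa only [rbtw, Set.mem_ofPred_eq, aux_lt a ha, aux_gt a ha] using ht
  · intro hs
    have h0 : 0 < s := by
      rcases hs with hs | hs
      · exact_mod_cast (aux_nonneg a x).trans_lt hs.1
      · exact_mod_cast (aux_nonneg a y).trans_lt hs.1
    have h1 : s = Real.exp (a * (Real.log s / a)) := by
      rw [mul_div_cancel₀ _ ha.ne', Real.exp_log h0]
    refine ⟨Real.log s / a, ?_, h1.symm⟩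
    rw [h1] at hs
    simpa only [rbtw, Set.mem_ofPred_eq, aux_lt a ha, aux_gt a ha] using hs

/-- The distance with weight `g`. -/
noncomputable def wdist (g : ℝ → ℝ) (p : EReal × EReal) : ℝ := ∫ t in rbtw p, g t

lemma wdist_neg (g : ℝ → ℝ) (hg : ∀ t, g (-t) = g t) (x y : EReal) :
    wdist g (-x, -y) = wdist g (x, y) := by
  have h := (MeasureTheory.Measure.measurePreserving_neg
    (MeasureTheory.volume : MeasureTheory.Measure ℝ)).setIntegral_preimage_emb
    (MeasurableEquiv.neg ℝ).measurableEmbedding g (rbtw (-x, -y))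
  rw [wdist, ← h, wdist]
  simp only [hg]
  congr 2
  ext t
  simp only [rbtw, Set.mem_preimage, Set.mem_ofPred_eq, EReal.coe_neg, EReal.neg_lt_neg_iff]
  tauto

lemma wdist_cont (g : ℝ → ℝ) (hg : MeasureTheory.Integrable g) : Continuous (wdist g) := by
  have e : wdist g = fun p => ∫ t, (rbtw p).indicator g t := by
    funext p
    rw [MeasureTheory.integral_indicator (btw_open p).measurableSet, wdist]
  rw [e, continuous_iff_continuousAt]
  rintro ⟨x, y⟩
  apply MeasureTheory.continuousAt_of_dominated (bound := fun t => ‖g t‖)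
  · exact Eventually.of_forall fun p =>
      (hg.indicator (btw_open p).measurableSet).aestronglyMeasurable
  · exact Eventually.of_forall fun p => Eventually.of_forall fun t =>
      norm_indicator_le_norm_self _ _
  · exact hg.norm
  · have hx : ∀ x : EReal, ∀ᵐ t : ℝ, (t : EReal) ≠ x := by
      intro x
      have : {t : ℝ | (t : EReal) = x}.Subsingleton := by
        intro s hs t ht
        exact EReal.coe_injective (hs.trans ht.symm)
      rw [MeasureTheory.ae_iff]
      simpa using this.measure_zero MeasureTheory.volume
    filter_upwards [hx x, hx y] with t h1 h2
    have k1 : ∀ᶠ p : EReal × EReal in 𝓝 (x, y), (p.1 < t ↔ x < t) ∧ ((t : EReal) < p.1 ↔ t < x) := by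
      rcases lt_or_gt_of_ne h1 with h | h
      · filter_upwards [continuousAt_fst.eventually (lt_mem_nhds h)] with p hp
        simp [h, hp, h.not_gt, hp.not_gt]
      · filter_upwards [continuousAt_fst.eventually (gt_mem_nhds h)] with p hp
        simp [h, hp, h.not_gt, hp.not_gt]
    have k2 : ∀ᶠ p : EReal × EReal in 𝓝 (x, y), (p.2 < t ↔ y < t) ∧ ((t : EReal) < p.2 ↔ t < y) := by
      rcases lt_or_gt_of_ne h2 with h | h
      · filter_upwards [continuousAt_snd.eventually (lt_mem_nhds h)] with p hp
        simp [h, hp, h.not_gt, hp.not_gt]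
      · filter_upwards [continuousAt_snd.eventually (gt_mem_nhds h)] with p hp
        simp [h, hp, h.not_gt, hp.not_gt]
    have k : (fun p => (rbtw p).indicator g t) =ᶠ[𝓝 (x, y)] fun _ => (rbtw (x, y)).indicator g t := by
      filter_upwards [k1, k2] with p h1 h2
      have : t ∈ rbtw p ↔ t ∈ rbtw (x, y) := by
        simp only [rbtw, Set.mem_ofPred_eq, h1.1, h1.2, h2.1, h2.2]
      by_cases hb : t ∈ rbtw (x, y)
      · rw [Set.indicator_of_mem hb, Set.indicator_of_mem (this.2 hb)]
      · rw [Set.indicator_of_notMem hb, Set.indicator_of_notMem (fun h => hb (this.1 h))]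
    exact k.continuousAt

lemma wdist_contract (a : ℝ) (ha : 0 < a) (φ : ℝ → ℝ) (hpos : ∀ x : ℝ, 0 < φ x)
    (hint : MeasureTheory.Integrable (fun t : ℝ => 1 / φ t) MeasureTheory.volume)
    (hineq : ∀ x : ℝ, a * Real.exp (a * x) * φ x ≤ φ (Real.exp (a * x)))
    (heq_fin : {x : ℝ | φ (Real.exp (a * x)) = a * Real.exp (a * x) * φ x}.Finite)
    (x y : EReal) (hxy : x ≠ y) :
    wdist (fun t => 1 / φ t) (fSgn a true x, fSgn a true y) < wdist (fun t => 1 / φ t) (x, y) := by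
  have hm : MeasurableSet (rbtw (x, y)) := (btw_open _).measurableSet
  have hd : ∀ t ∈ rbtw (x, y), HasDerivWithinAt (fun t => Real.exp (a * t))
      (a * Real.exp (a * t)) (rbtw (x, y)) t := by
    intro t _
    have := ((hasDerivAt_id t).const_mul a).exp
    simp only [id, mul_one] at this
    rw [mul_comm]
    exact this.hasDerivWithinAt
  have hi : Set.InjOn (fun t => Real.exp (a * t)) (rbtw (x, y)) := by
    intro s _ t _ h
    exact mul_left_cancel₀ ha.ne' (Real.exp_injective h)
  have e1 := MeasureTheory.integral_image_eq_integral_abs_deriv_smul hm hd hi (fun t => 1 / φ t)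
  have e2 := (MeasureTheory.integrableOn_image_iff_integrableOn_abs_deriv_smul hm hd hi
    (fun t => 1 / φ t)).1 hint.integrableOn
  rw [wdist, wdist, ← btw_image a ha, e1, ← sub_pos,
    ← MeasureTheory.integral_sub hint.integrableOn e2]
  have habs : ∀ t, |a * Real.exp (a * t)| = a * Real.exp (a * t) := fun t =>
    abs_of_pos (mul_pos ha (Real.exp_pos _))
  have hle : ∀ t, 0 ≤ 1 / φ t - |a * Real.exp (a * t)| • (1 / φ (Real.exp (a * t))) := by
    intro t
    rw [habs, smul_eq_mul, mul_one_div, sub_nonneg, div_le_div_iff₀ (hpos _) (hpos _)]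
    linarith [hineq t]
  have hne : ∀ t, φ (Real.exp (a * t)) ≠ a * Real.exp (a * t) * φ t →
      1 / φ t - |a * Real.exp (a * t)| • (1 / φ (Real.exp (a * t))) ≠ 0 := by
    intro t ht h
    apply ht
    rw [habs, smul_eq_mul, mul_one_div, sub_eq_zero,
      div_eq_div_iff (hpos _).ne' (hpos _).ne'] at h
    linarith
  rw [MeasureTheory.setIntegral_pos_iff_support_of_nonneg_ae
    (Eventually.of_forall hle) (hint.integrableOn.sub e2)]
  have hp : 0 < MeasureTheory.volume (rbtw (x, y)) :=
    (btw_open _).measure_pos _ (btw_nonempty hxy)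
  rw [← MeasureTheory.measure_sdiff_null (heq_fin.measure_zero _)] at hp
  refine hp.trans_le (MeasureTheory.measure_mono ?_)
  rintro t ⟨h1, h2⟩
  exact ⟨hne t h2, h1⟩

/-- If there is a continuous, even, strictly positive `φ : ℝ → ℝ` with
`∫ 1/φ < ∞` and `φ(e^{a·x}) ≥ a·e^{a·x}·φ(x)` for all `x`, with equality only on a finite
set, then every `I(ε)` is a subsingleton. -/
theorem Iset_subsingleton_of_contracting_weight (a : ℝ) (ha : 0 < a) (φ : ℝ → ℝ)
    (hcont : Continuous φ) (heven : ∀ x : ℝ, φ (-x) = φ x) (hpos : ∀ x : ℝ, 0 < φ x)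
    (hint : MeasureTheory.Integrable (fun t : ℝ => 1 / φ t) MeasureTheory.volume)
    (hineq : ∀ x : ℝ, a * Real.exp (a * x) * φ x ≤ φ (Real.exp (a * x)))
    (heq_fin : {x : ℝ | φ (Real.exp (a * x)) = a * Real.exp (a * x) * φ x}.Finite) :
    ∀ ε : ℕ → Bool, (Iset a ε).Subsingleton := by
  intro ε x hx y hy
  by_contra hxy
  obtain ⟨p, hp0, hp⟩ := aux_seq a ha ε x hx
  obtain ⟨q, hq0, hq⟩ := aux_seq a ha ε y hy
  set g : ℝ → ℝ := fun t => 1 / φ t with hg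
  have hc := wdist_cont g hint
  have hcon := wdist_contract a ha φ hpos hint hineq heq_fin
  have hev : ∀ t, g (-t) = g t := fun t => by simp only [hg, heven]
  have hstep : ∀ n, wdist g (p n, q n) =
      wdist g (fSgn a true (p (n + 1)), fSgn a true (q (n + 1))) := by
    intro n
    rw [hp n, hq n]
    cases ε n
    · rw [aux_false, aux_false, wdist_neg g hev]
    · rfl
  have hself : ∀ z, wdist g (z, z) = 0 := by
    intro z
    have : rbtw (z, z) = ∅ := by
      ext t
      simp only [rbtw, Set.mem_ofPred_eq, Set.mem_empty_iff_false, iff_false]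
      rintro (h | h) <;> exact lt_asymm h.1 h.2
    rw [wdist, this, MeasureTheory.setIntegral_empty]
  have hne : ∀ n, p n ≠ q n := by
    intro n
    induction n with
    | zero => rwa [hp0, hq0]
    | succ n ih =>
      intro h
      apply ih
      rw [hp n, hq n, h]
  have hmono : Monotone fun n => wdist g (p n, q n) := by
    apply monotone_nat_of_le_succ
    intro n
    rw [hstep n]
    exact (hcon _ _ (hne _)).le
  have hpos1 : 0 < wdist g (p 1, q 1) := by
    refine lt_of_le_of_lt ?_ (hcon _ _ (hne 1))
    exact MeasureTheory.setIntegral_nonneg (btw_open _).measurableSet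
      fun t _ => (one_div_pos.2 (hpos t)).le
  have hbdd : BddAbove (Set.range fun n => wdist g (p n, q n)) :=
    (isCompact_range hc).bddAbove.mono (by rintro _ ⟨n, rfl⟩; exact ⟨_, rfl⟩)
  have hlim := tendsto_atTop_ciSup hmono hbdd
  set δ := ⨆ n, wdist g (p n, q n) with hδ
  have hδpos : 0 < δ := hpos1.trans_le (le_ciSup hbdd 1)
  obtain ⟨⟨u, v⟩, ψ, hψ, hconv⟩ :=
    CompactSpace.tendsto_subseq (fun n => (p (n + 1), q (n + 1)))
  have l1 : Tendsto (fun k => wdist g (p (ψ k + 1), q (ψ k + 1))) atTop (𝓝 (wdist g (u, v))) :=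
    (hc.tendsto _).comp hconv
  have l2 : Tendsto (fun k => wdist g (p (ψ k + 1), q (ψ k + 1))) atTop (𝓝 δ) :=
    hlim.comp ((tendsto_add_atTop_nat 1).comp hψ.tendsto_atTop)
  have hcf : Continuous fun z : EReal × EReal => wdist g (fSgn a true z.1, fSgn a true z.2) :=
    hc.comp (((aux_cont a ha).comp continuous_fst).prodMk ((aux_cont a ha).comp continuous_snd))
  have l3 : Tendsto (fun k => wdist g (p (ψ k), q (ψ k))) atTop
      (𝓝 (wdist g (fSgn a true u, fSgn a true v))) := by
    have := (hcf.tendsto (u, v)).comp hconv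
    refine this.congr fun k => ?_
    exact (hstep (ψ k)).symm
  have l4 : Tendsto (fun k => wdist g (p (ψ k), q (ψ k))) atTop (𝓝 δ) :=
    hlim.comp hψ.tendsto_atTop
  have e1 := tendsto_nhds_unique l1 l2
  have e2 := tendsto_nhds_unique l3 l4
  have huv : u ≠ v := by
    rintro rfl
    rw [hself] at e1
    exact hδpos.ne e1
  have := hcon u v huv
  rw [e1, e2] at this
  exact lt_irrefl _ this
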